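/- For all m ≥ 0 and pairwise distinct general atoms R₁,…,R_m, P, Q, the formula (R₁∧…∧R_m∧P → Q) → (R₁∧…∧R_m → (P → Q)) is provable in CL2. -/

import Mathlib

/-- CL2-formulas: logical atoms ⊤/⊥, elementary atoms, general atoms,
negation, n-ary ∧, ∨, ⊓, ⊔ (arities other than ≥2 never arise in derivations
of proper formulas). -/
inductive CL2 : Type where
  | top : CL2
  | bot : CL2
  | elem : Nat → CL2
  | gen : Nat → CL2
  | neg : CL2 → CL2
  | land : List CL2 → CL2
  | lor : List CL2 → CL2
  | chand : List CL2 → CL2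
  | chor : List CL2 → CL2

namespace CL2

/-- Elementarization (with a polarity parameter): surface ⊓ becomes ⊤, surface ⊔
becomes ⊥, positive surface general atoms become ⊥, negative ones ⊤. -/
def elz (pos : Bool) : CL2 → CL2
  | top => top
  | bot => bot
  | elem n => elem n
  | gen _ => if pos then bot else top
  | neg F => neg (elz (!pos) F)
  | land l => land (l.attach.map (fun x => elz pos x.1))
  | lor l => lor (l.attach.map (fun x => elz pos x.1))
  | chand _ => top
  | chor _ => bot
termination_by F => sizeOf F
decreasing_by
  all_goals simp_wf
  all_goals first
    | omega
    | (have h := List.sizeOf_lt_of_mem x.2; omega)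

/-- Classical evaluation (used on elementarizations, which contain no
general atoms and no ⊓/⊔). -/
def eval (v : Nat → Bool) : CL2 → Bool
  | top => true
  | bot => false
  | elem n => v n
  | gen _ => false
  | neg F => !(eval v F)
  | land l => (l.attach.map (fun x => eval v x.1)).all id
  | lor l => (l.attach.map (fun x => eval v x.1)).any id
  | chand _ => true
  | chor _ => false
termination_by F => sizeOf F
decreasing_by
  all_goals simp_wf
  all_goals first
    | omega
    | (have h := List.sizeOf_lt_of_mem x.2; omega)

/-- F is stable iff its elementarization is a classical tautology. -/
def Stable (F : CL2) : Prop := ∀ v : Nat → Bool, eval v (elz true F) = true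

/-- Whether the elementary atom `p` occurs (anywhere) in a formula. -/
def elemOccurs (p : Nat) : CL2 → Bool
  | top => false
  | bot => false
  | elem n => n == p
  | gen _ => false
  | neg F => elemOccurs p F
  | land l => (l.attach.map (fun x => elemOccurs p x.1)).any id
  | lor l => (l.attach.map (fun x => elemOccurs p x.1)).any id
  | chand l => (l.attach.map (fun x => elemOccurs p x.1)).any id
  | chor l => (l.attach.map (fun x => elemOccurs p x.1)).any id
termination_by F => sizeOf F
decreasing_by
  all_goals simp_wf
  all_goals first
    | omega
    | (have h := List.sizeOf_lt_of_mem x.2; omega)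

end CL2

/-- One-hole surface contexts: the hole is not in the scope of ⊓ or ⊔. -/
inductive SCtx : Type where
  | hole : SCtx
  | neg : SCtx → SCtx
  | land : List CL2 → SCtx → List CL2 → SCtx
  | lor : List CL2 → SCtx → List CL2 → SCtx

namespace SCtx

def fill : SCtx → CL2 → CL2
  | hole, F => F
  | neg C, F => CL2.neg (fill C F)
  | land l C r, F => CL2.land (l ++ fill C F :: r)
  | lor l C r, F => CL2.lor (l ++ fill C F :: r)

/-- Number of negations the hole is in the scope of. -/
def negCount : SCtx → Nat
  | hole => 0
  | neg C => negCount C + 1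
  | land _ C _ => negCount C
  | lor _ C _ => negCount C

end SCtx

/-- Two-hole surface contexts (the two holes are distinct surface occurrences,
so their least common ancestor is an ∧- or ∨-node). -/
inductive DCtx : Type where
  | neg : DCtx → DCtx
  | land : List CL2 → DCtx → List CL2 → DCtx
  | lor : List CL2 → DCtx → List CL2 → DCtx
  | landS : List CL2 → SCtx → List CL2 → SCtx → List CL2 → DCtx
  | lorS : List CL2 → SCtx → List CL2 → SCtx → List CL2 → DCtx

namespace DCtx

def fill2 : DCtx → CL2 → CL2 → CL2
  | neg D, A, B => CL2.neg (fill2 D A B)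
  | land l D r, A, B => CL2.land (l ++ fill2 D A B :: r)
  | lor l D r, A, B => CL2.lor (l ++ fill2 D A B :: r)
  | landS l C1 m C2 r, A, B => CL2.land (l ++ C1.fill A :: m ++ C2.fill B :: r)
  | lorS l C1 m C2 r, A, B => CL2.lor (l ++ C1.fill A :: m ++ C2.fill B :: r)

def negCount1 : DCtx → Nat
  | neg D => negCount1 D + 1
  | land _ D _ => negCount1 D
  | lor _ D _ => negCount1 D
  | landS _ C1 _ _ _ => C1.negCount
  | lorS _ C1 _ _ _ => C1.negCount

def negCount2 : DCtx → Nat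
  | neg D => negCount2 D + 1
  | land _ D _ => negCount2 D
  | lor _ D _ => negCount2 D
  | landS _ _ _ C2 _ => C2.negCount
  | lorS _ _ _ C2 _ => C2.negCount

end DCtx

/-- The premises of Rule (a) with conclusion `F`: results of replacing a positive
surface occurrence of a ⊓-subformula, or a negative surface occurrence of a
⊔-subformula, by one of its components. -/
def PremiseA (F H : CL2) : Prop :=
  ∃ (C : SCtx) (Gs : List CL2) (i : Fin Gs.length),
    (Even C.negCount ∧ F = C.fill (CL2.chand Gs) ∧ H = C.fill (Gs.get i)) ∨
    (Odd C.negCount ∧ F = C.fill (CL2.chor Gs) ∧ H = C.fill (Gs.get i))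

/-- The premise of Rule (b): `H` results from replacing in `F` a negative surface
occurrence of a ⊓-subformula, or a positive surface occurrence of a ⊔-subformula,
by one of its components. -/
def PremiseB (F H : CL2) : Prop :=
  ∃ (C : SCtx) (Gs : List CL2) (i : Fin Gs.length),
    (Odd C.negCount ∧ F = C.fill (CL2.chand Gs) ∧ H = C.fill (Gs.get i)) ∨
    (Even C.negCount ∧ F = C.fill (CL2.chor Gs) ∧ H = C.fill (Gs.get i))

/-- The premise of Rule (c): `H` results from replacing in `F` two — one positive
and one negative — surface occurrences of a general atom by an elementary atom
not occurring in `F`. -/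
def PremiseC (F H : CL2) : Prop :=
  ∃ (D : DCtx) (P p : Nat),
    F = D.fill2 (CL2.gen P) (CL2.gen P) ∧
    H = D.fill2 (CL2.elem p) (CL2.elem p) ∧
    ((Even D.negCount1 ∧ Odd D.negCount2) ∨ (Odd D.negCount1 ∧ Even D.negCount2)) ∧
    CL2.elemOccurs p F = false

/-- CL2-provability. -/
inductive Provable : CL2 → Prop where
  | ruleA (F : CL2) : CL2.Stable F → (∀ H, PremiseA F H → Provable H) → Provable F
  | ruleB (F H : CL2) : PremiseB F H → Provable H → Provable F
  | ruleC (F H : CL2) : PremiseC F H → Provable H → Provable F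

/-- Implication: F → G abbreviates ¬F ∨ G. -/
def CL2.imp (F G : CL2) : CL2 := CL2.lor [CL2.neg F, G]

/-- `conjImp [F₁,…,Fₙ] T` is F₁∧…∧Fₙ → T, with the conventions that for n = 1 it
is F₁ → T and for n = 0 it is T. -/
def conjImp (l : List CL2) (t : CL2) : CL2 :=
  match l with
  | [] => t
  | [f] => CL2.imp f t
  | l => CL2.imp (CL2.land l) t

/-- `conj1 [F₁,…,Fₙ]` is F₁∧…∧Fₙ, with the convention that for n = 1 it is F₁. -/
def conj1 (l : List CL2) : CL2 :=
  match l with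
  | [f] => f
  | l => CL2.land l

namespace CL2

lemma eval_land (v : Nat → Bool) (l : List CL2) : eval v (land l) = l.all (eval v) := by
  rw [eval]
  simp

lemma eval_lor (v : Nat → Bool) (l : List CL2) : eval v (lor l) = l.any (eval v) := by
  rw [eval]
  simp

lemma elemOccurs_land (p : Nat) (l : List CL2) :
    elemOccurs p (land l) = l.any (elemOccurs p) := by
  rw [elemOccurs]
  simp

lemma elemOccurs_lor (p : Nat) (l : List CL2) :
    elemOccurs p (lor l) = l.any (elemOccurs p) := by
  rw [elemOccurs]
  simp

lemma eval_imp (v : Nat → Bool) (F G : CL2) : eval v (imp F G) = (!eval v F || eval v G) := by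
  simp [imp, eval_lor, eval]

lemma elemOccurs_imp (p : Nat) (F G : CL2) :
    elemOccurs p (imp F G) = (elemOccurs p F || elemOccurs p G) := by
  simp [imp, elemOccurs_lor, elemOccurs]

/-- Formulas built from elementary atoms by ¬, ∧ and ∨ only. -/
inductive Elementary : CL2 → Prop where
  | elem (n : Nat) : Elementary (elem n)
  | neg {F : CL2} : Elementary F → Elementary (neg F)
  | land {l : List CL2} : (∀ F ∈ l, Elementary F) → Elementary (land l)
  | lor {l : List CL2} : (∀ F ∈ l, Elementary F) → Elementary (lor l)

lemma Elementary.imp {F G : CL2} (hF : Elementary F) (hG : Elementary G) :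
    Elementary (CL2.imp F G) :=
  .lor (by simp [hF.neg, hG])

lemma Elementary.elz_eq {F : CL2} (hF : Elementary F) (pos : Bool) : elz pos F = F := by
  induction hF generalizing pos with
  | elem n => simp [elz]
  | neg _ ih => simp [elz, ih]
  | @land l _ ih =>
    simp [elz, List.map_congr_left fun F hF => ih F hF pos]
  | @lor l _ ih =>
    simp [elz, List.map_congr_left fun F hF => ih F hF pos]

lemma Elementary.of_fill {C : SCtx} {F : CL2} (h : Elementary (C.fill F)) : Elementary F := by
  induction C with
  | hole => exact h
  | neg C ih => cases h with | neg h => exact ih h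
  | land l C r ih => cases h with | land h => exact ih (h _ (by simp))
  | lor l C r ih => cases h with | lor h => exact ih (h _ (by simp))

lemma Elementary.not_premiseA {F H : CL2} (hF : Elementary F) : ¬ PremiseA F H := by
  rintro ⟨C, Gs, i, ⟨-, rfl, -⟩ | ⟨-, rfl, -⟩⟩ <;> cases hF.of_fill

lemma Elementary.provable {F : CL2} (hF : Elementary F) (h : ∀ v, eval v F = true) :
    Provable F :=
  .ruleA F (fun v => by rw [hF.elz_eq, h v]) fun _ hH => (hF.not_premiseA hH).elim

end CL2

open CL2

lemma conjImp_of_ne_nil {l : List CL2} (hl : l ≠ []) (T : CL2) :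
    conjImp l T = imp (conj1 l) T := by
  match l, hl with
  | [_], _ => rfl
  | _ :: _ :: _, _ => rfl

lemma eval_conj1 (v : Nat → Bool) (l : List CL2) : eval v (conj1 l) = l.all (eval v) := by
  match l with
  | [] => simp [conj1, eval_land]
  | [_] => simp [conj1]
  | _ :: _ :: _ => simp [conj1, eval_land]

lemma eval_conjImp (v : Nat → Bool) (l : List CL2) (T : CL2) :
    eval v (conjImp l T) = (!l.all (eval v) || eval v T) := by
  by_cases hl : l = []
  · subst hl
    simp [conjImp]
  · rw [conjImp_of_ne_nil hl, eval_imp, eval_conj1]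

lemma elemOccurs_conj1 (p : Nat) (l : List CL2) :
    elemOccurs p (conj1 l) = l.any (elemOccurs p) := by
  match l with
  | [] => simp [conj1, elemOccurs_land]
  | [_] => simp [conj1]
  | _ :: _ :: _ => simp [conj1, elemOccurs_land]

lemma elemOccurs_conjImp (p : Nat) (l : List CL2) (T : CL2) :
    elemOccurs p (conjImp l T) = (l.any (elemOccurs p) || elemOccurs p T) := by
  by_cases hl : l = []
  · subst hl
    simp [conjImp]
  · rw [conjImp_of_ne_nil hl, elemOccurs_imp, elemOccurs_conj1]

lemma CL2.Elementary.conjImp {l : List CL2} {T : CL2} (hl : ∀ F ∈ l, Elementary F)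
    (hT : Elementary T) : Elementary (conjImp l T) := by
  match l, hl with
  | [], _ => exact hT
  | [F], hl => exact (hl F (by simp)).imp hT
  | _ :: _ :: _, hl => exact (Elementary.land hl).imp hT

/-- The surface context isolating one conjunct of a conjunction. -/
lemma exists_sctx_conj1 (l r : List CL2) :
    ∃ C : SCtx, C.negCount = 0 ∧ ∀ F, conj1 (l ++ F :: r) = C.fill F := by
  match l, r with
  | [], [] => exact ⟨.hole, rfl, fun _ => rfl⟩
  | [], G :: r => exact ⟨.land [] .hole (G :: r), rfl, fun _ => rfl⟩
  | [G], r => exact ⟨.land [G] .hole r, rfl, fun _ => rfl⟩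
  | G :: G' :: l, r => exact ⟨.land (G :: G' :: l) .hole r, rfl, fun _ => rfl⟩

/-- The surface context isolating the consequent of `conjImp`. -/
lemma exists_sctx_conjImp (l : List CL2) :
    ∃ C : SCtx, C.negCount = 0 ∧ ∀ T, conjImp l T = C.fill T := by
  by_cases hl : l = []
  · subst hl
    exact ⟨.hole, rfl, fun _ => rfl⟩
  · exact ⟨.lor [neg (conj1 l)] .hole [], rfl, fun T => conjImp_of_ne_nil hl T⟩

/-- Composition of surface contexts. -/
def SCtx.comp : SCtx → SCtx → SCtx
  | hole, D => D
  | neg C, D => neg (C.comp D)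
  | land l C r, D => land l (C.comp D) r
  | lor l C r, D => lor l (C.comp D) r

lemma SCtx.fill_comp (C D : SCtx) (F : CL2) : (C.comp D).fill F = C.fill (D.fill F) := by
  induction C <;> simp_all [SCtx.comp, SCtx.fill]

lemma SCtx.negCount_comp (C D : SCtx) :
    (C.comp D).negCount = C.negCount + D.negCount := by
  induction C <;> simp_all [SCtx.comp, SCtx.negCount, Nat.add_right_comm]

/-- The formula (l₁∧…∧lₙ∧A → B) → (l₁∧…∧lₙ → (A → B)). -/
def curryFormula (l : List CL2) (A B : CL2) : CL2 :=
  imp (conjImp (l ++ [A]) B) (conjImp l (imp A B))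

/-- Rule (c) applied to an implication, with one occurrence in the antecedent and one in the
consequent. -/
lemma provable_imp_of_elem (C D : SCtx) (X p : Nat)
    (hpar : Even (C.negCount + D.negCount))
    (hp : elemOccurs p (imp (C.fill (gen X)) (D.fill (gen X))) = false)
    (h : Provable (imp (C.fill (elem p)) (D.fill (elem p)))) :
    Provable (imp (C.fill (gen X)) (D.fill (gen X))) := by
  refine .ruleC _ _ ⟨.lorS [] (.neg C) [] D [], X, p, rfl, rfl, ?_, hp⟩ h
  simp only [DCtx.negCount1, DCtx.negCount2, SCtx.negCount, Nat.even_iff, Nat.odd_iff] at hpar ⊢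
  omega

lemma elemOccurs_curryFormula (p : Nat) (l : List CL2) (A B : CL2) :
    elemOccurs p (curryFormula l A B) =
      (l.any (elemOccurs p) || elemOccurs p A || elemOccurs p B) := by
  simp only [curryFormula, elemOccurs_imp, elemOccurs_conjImp, List.any_append, List.any_cons,
    List.any_nil]
  grind

lemma provable_curryFormula_of_consequent (l : List CL2) (A : CL2) (X p : Nat)
    (hp : elemOccurs p (curryFormula l A (gen X)) = false)
    (h : Provable (curryFormula l A (elem p))) : Provable (curryFormula l A (gen X)) := by
  obtain ⟨C, hC, hCfill⟩ := exists_sctx_conjImp (l ++ [A])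
  obtain ⟨D, hD, hDfill⟩ := exists_sctx_conjImp l
  have key (B : CL2) : curryFormula l A B =
      imp (C.fill B) ((D.comp (.lor [neg A] .hole [])).fill B) := by
    rw [curryFormula, hCfill, hDfill, SCtx.fill_comp]
    rfl
  rw [key] at hp h ⊢
  exact provable_imp_of_elem _ _ X p (by simp [SCtx.negCount_comp, SCtx.negCount, hC, hD]) hp h

lemma provable_curryFormula_of_antecedent (l : List CL2) (B : CL2) (X p : Nat)
    (hp : elemOccurs p (curryFormula l (gen X) B) = false)
    (h : Provable (curryFormula l (elem p) B)) : Provable (curryFormula l (gen X) B) := by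
  obtain ⟨C, hC, hCfill⟩ := exists_sctx_conj1 l []
  obtain ⟨D, hD, hDfill⟩ := exists_sctx_conjImp l
  have key (A : CL2) : curryFormula l A B =
      imp ((SCtx.lor [] (.neg C) [B]).fill A)
        ((D.comp (.lor [] (.neg .hole) [B])).fill A) := by
    rw [curryFormula, conjImp_of_ne_nil (by simp), hCfill, hDfill, SCtx.fill_comp]
    rfl
  rw [key] at hp h ⊢
  exact provable_imp_of_elem _ _ X p (by simp [SCtx.negCount_comp, SCtx.negCount, hC, hD]) hp h

lemma provable_curryFormula_of_conjunct (l r : List CL2) (A B : CL2) (X p : Nat)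
    (hp : elemOccurs p (curryFormula (l ++ gen X :: r) A B) = false)
    (h : Provable (curryFormula (l ++ elem p :: r) A B)) :
    Provable (curryFormula (l ++ gen X :: r) A B) := by
  obtain ⟨C, hC, hCfill⟩ := exists_sctx_conj1 l (r ++ [A])
  obtain ⟨D, hD, hDfill⟩ := exists_sctx_conj1 l r
  have key (F : CL2) : curryFormula (l ++ F :: r) A B =
      imp ((SCtx.lor [] (.neg C) [B]).fill F)
        ((SCtx.lor [] (.neg D) [imp A B]).fill F) := by
    rw [curryFormula, conjImp_of_ne_nil (by simp), conjImp_of_ne_nil (by simp),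
      List.append_assoc, List.cons_append, hCfill, hDfill]
    rfl
  rw [key] at hp h ⊢
  exact provable_imp_of_elem _ _ X p (by simp [SCtx.negCount, hC, hD]) hp h

lemma provable_curryFormula_elem (l : List Nat) (a b : Nat) :
    Provable (curryFormula (l.map elem) (elem a) (elem b)) := by
  have hl : ∀ F ∈ l.map elem, Elementary F := by
    simpa using fun n _ => Elementary.elem n
  refine Elementary.provable (.imp (.conjImp ?_ (.elem b)) (.conjImp hl (.imp (.elem a) (.elem b))))
    fun v => ?_
  · simp [or_imp, forall_and, Elementary.elem]
  · simp only [curryFormula, eval_imp, eval_conjImp, List.all_append, List.all_cons, List.all_nil]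
    grind

lemma provable_curryFormula_elem_gen (done rest : List Nat) (a b : Nat) :
    Provable (curryFormula (done.map elem ++ rest.map gen) (elem a) (elem b)) := by
  induction rest generalizing done with
  | nil => simpa using provable_curryFormula_elem done a b
  | cons X rest ih =>
    obtain ⟨p, hp⟩ := Infinite.exists_notMem_finset (a :: b :: done).toFinset
    refine provable_curryFormula_of_conjunct _ _ _ _ X p ?_ (by simpa using ih (done ++ [p]))
    rw [elemOccurs_curryFormula]
    simp [elemOccurs] at hp ⊢
    grind

/-- Lemma 8(d): for all m ≥ 0 and pairwise distinct general atoms R₁,…,R_m, P, Q,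
the formula (R₁∧…∧R_m∧P → Q) → (R₁∧…∧R_m → (P → Q)) is provable in CL2. -/
theorem cl2_provable_curry (m : Nat) (R : Fin m → Nat) (P Q : Nat)
    (hdist : (List.ofFn R ++ [P, Q]).Nodup) :
    Provable (CL2.imp
      (conjImp ((List.ofFn R).map CL2.gen ++ [CL2.gen P]) (CL2.gen Q))
      (conjImp ((List.ofFn R).map CL2.gen) (CL2.imp (CL2.gen P) (CL2.gen Q)))) := by
  change Provable (curryFormula _ _ _)
  refine provable_curryFormula_of_consequent _ _ Q 1 ?_
    (provable_curryFormula_of_antecedent _ _ P 0 ?_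
      (provable_curryFormula_elem_gen [] (List.ofFn R) 0 1))
  all_goals simp [elemOccurs_curryFormula, elemOccurs]
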